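/- Let β : [0, ∞) → [0, ∞) be measurable and locally integrable, set B(t) = ∫₀ᵗ β(s) ds, and assume B(t) → ∞ as t → ∞, so that g(t) = β(t) exp(−B(t)) for t ≥ 0 is a probability density. Let X have density g and let σ ≥ 0 be independent of X with continuous cumulative distribution function F. Then for every T > 0: P( X ≥ T | X + σ ≥ T ) = exp(−B(T)) / ( ∫₀^T β(r) exp(−B(r)) (1 − F(T − r)) dr + exp(−B(T)) ). -/

import Mathlib

open MeasureTheory ProbabilityTheory intervalIntegral

lemma aux_int (β : ℝ → ℝ) (hβ0 : ∀ s, 0 ≤ s → 0 ≤ β s)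
    (hβloc : ∀ a : ℝ, IntervalIntegrable β volume 0 a)
    (B : ℝ → ℝ) (hB : ∀ a, B a = ∫ s in (0 : ℝ)..a, β s)
    (T : ℝ) (hT : 0 < T) :
    ∫ r in (0 : ℝ)..T, β r * Real.exp (-B r) = 1 - Real.exp (-B T) := by
  have hBf : B = fun a => ∫ s in (0 : ℝ)..a, β s := funext hB
  have hac : AbsolutelyContinuousOnInterval B 0 T := by
    rw [hBf]
    exact (hβloc T).absolutelyContinuousOnInterval_intervalIntegral (by simp)
  have hBnn : ∀ x, 0 ≤ x → 0 ≤ B x := by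
    intro x hx
    rw [hB]
    exact intervalIntegral.integral_nonneg hx (fun u hu => hβ0 u hu.1)
  have hlip : ∀ x y : ℝ, 0 ≤ x → 0 ≤ y → dist (Real.exp (-x)) (Real.exp (-y)) ≤ dist x y := by
    have key : ∀ x y : ℝ, 0 ≤ x → x ≤ y → Real.exp (-x) - Real.exp (-y) ≤ y - x := by
      intro x y hx hxy
      have h1 : Real.exp (-y) = Real.exp (-x) * Real.exp (-(y-x)) := by
        rw [← Real.exp_add]; ring_nf
      have h2 := Real.add_one_le_exp (-(y-x))
      have h3 : Real.exp (-x) ≤ 1 := Real.exp_le_one_iff.2 (by linarith)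
      have h4 := Real.exp_pos (-x)
      rw [h1]
      nlinarith
    intro x y hx hy
    rcases le_total x y with h | h
    · rw [Real.dist_eq, Real.dist_eq, abs_of_nonneg, abs_of_nonpos]
      · linarith [key x y hx h]
      · linarith
      · have := Real.exp_le_exp.2 (neg_le_neg h); linarith
    · rw [Real.dist_eq, Real.dist_eq, abs_of_nonpos, abs_of_nonneg]
      · linarith [key y x hy h]
      · linarith
      · have := Real.exp_le_exp.2 (neg_le_neg h); linarith
  have hac2 : AbsolutelyContinuousOnInterval (fun x => Real.exp (-B x)) 0 T := by
    rw [absolutelyContinuousOnInterval_iff] at hac ⊢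
    intro ε hε
    obtain ⟨δ, hδ, h⟩ := hac ε hε
    refine ⟨δ, hδ, fun E hE hs => lt_of_le_of_lt (Finset.sum_le_sum fun i hi => ?_) (h E hE hs)⟩
    have := hE.1 i hi
    rw [Set.uIcc_of_le hT.le] at this
    exact hlip _ _ (hBnn _ this.1.1) (hBnn _ this.2.1)
  have hftc := hac2.integral_deriv_eq_sub
  have hB0 : B 0 = 0 := by simp [hB]
  have hcongr : ∫ r in (0 : ℝ)..T, deriv (fun x => Real.exp (-B x)) r
      = ∫ r in (0 : ℝ)..T, -(β r * Real.exp (-B r)) := by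
    apply intervalIntegral.integral_congr_ae
    filter_upwards [(hβloc T).ae_hasDerivAt_integral] with x hx hx2
    have h := hx (Set.uIoc_subset_uIcc hx2) 0 (by simp)
    rw [← hBf] at h
    have h2 : HasDerivAt (fun x => Real.exp (-B x)) (Real.exp (-B x) * -(β x)) x := h.neg.exp
    rw [h2.deriv]
    ring
  rw [hcongr, intervalIntegral.integral_neg, hB0] at hftc
  simp at hftc
  linarith

lemma aux_dens (β : ℝ → ℝ) (hβm : Measurable β) (hβ0 : ∀ s, 0 ≤ s → 0 ≤ β s)
    (hβloc : ∀ a : ℝ, IntervalIntegrable β volume 0 a)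
    (B : ℝ → ℝ) (hBc : Continuous B) (φ : ℝ → ℝ) (hφ : Continuous φ) (hφ0 : ∀ x, 0 ≤ φ x)
    (T : ℝ) (hT : 0 < T) :
    ∫⁻ x in Set.Iio T, ENNReal.ofReal (if 0 ≤ x then β x * Real.exp (-B x) else 0)
        * ENNReal.ofReal (φ x)
      = ENNReal.ofReal (∫ r in (0 : ℝ)..T, β r * Real.exp (-B r) * φ r) := by
  have hint : IntervalIntegrable (fun r => β r * Real.exp (-B r) * φ r) volume 0 T := by
    have hc : Continuous fun r => Real.exp (-B r) * φ r := by fun_prop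
    simpa [mul_assoc] using (hβloc T).mul_continuousOn hc.continuousOn
  rw [intervalIntegral.integral_of_le hT.le, ofReal_integral_eq_lintegral_ofReal hint.1]
  · rw [← lintegral_indicator measurableSet_Iio, ← lintegral_indicator measurableSet_Ioc]
    apply lintegral_congr_ae
    have h1 : ∀ᵐ x : ℝ, x ≠ 0 := by simp [ae_iff, measure_singleton]
    have h2 : ∀ᵐ x : ℝ, x ≠ T := by simp [ae_iff, measure_singleton]
    filter_upwards [h1, h2] with x hx0 hxT
    by_cases ha : x < 0
    · simp [Set.indicator, not_le.2 ha, not_lt.2 ha.le]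
    · have hx : 0 < x := lt_of_le_of_ne (not_lt.1 ha) (Ne.symm hx0)
      by_cases hb : x < T
      · simp only [Set.indicator, Set.mem_Iio, hb, Set.mem_Ioc, hx, hb.le, hx.le, if_true,
          and_self]
        rw [ENNReal.ofReal_mul (mul_nonneg (hβ0 x hx.le) (Real.exp_pos _).le)]
      · have hb2 : ¬ x ≤ T := fun h => hb (lt_of_le_of_ne h hxT)
        simp [Set.indicator, hb, hb2]
  · filter_upwards [ae_restrict_mem measurableSet_Ioc] with x hx
    exact mul_nonneg (mul_nonneg (hβ0 x hx.1.le) (Real.exp_pos _).le) (hφ0 x)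

lemma aux_tail {Ω : Type*} [MeasureSpace Ω] [IsProbabilityMeasure (ℙ : Measure Ω)]
    (σ : Ω → ℝ) (hσm : Measurable σ)
    (F : ℝ → ℝ) (hF : ∀ a, F a = (ℙ {ω | σ ω ≤ a}).toReal) (hFc : Continuous F) (a : ℝ) :
    ℙ {ω | a ≤ σ ω} = ENNReal.ofReal (1 - F a) := by
  have hlt : (ℙ : Measure Ω).real {ω | σ ω < a} = F a := by
    apply le_antisymm
    · rw [hF]
      exact measureReal_mono (fun ω (h : σ ω < a) => h.le)
    · have ht : Filter.Tendsto F (nhdsWithin a (Set.Iio a)) (nhds (F a)) :=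
        hFc.continuousAt.tendsto.mono_left nhdsWithin_le_nhds
      refine le_of_tendsto ht ?_
      filter_upwards [self_mem_nhdsWithin] with y hy
      rw [hF]
      exact measureReal_mono (fun ω (h : σ ω ≤ y) => lt_of_le_of_lt h hy)
  have hc : {ω | a ≤ σ ω} = {ω | σ ω < a}ᶜ := by ext; simp
  have hm : MeasurableSet {ω | σ ω < a} := measurableSet_lt hσm measurable_const
  rw [hc, ← hlt, ← probReal_compl_eq_one_sub hm, ofReal_measureReal]


/-- (Appendix B.1 of the paper: atomic mass at the observation
horizon.)  With `X` having density `g(t) = β(t) exp(−B(t))` on `[0, ∞)`, `B(t) = ∫₀ᵗ β`,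
`B(t) → ∞`, and `σ ≥ 0` independent of `X` with continuous cdf `F`, for every `T > 0`:
`P(X ≥ T ∣ X + σ ≥ T)
  = e^{−B(T)} / (∫₀^T β(r) e^{−B(r)} (1 − F(T−r)) dr + e^{−B(T)})`. -/
theorem conditional_susceptible_atom
    {Ω : Type*} [MeasureSpace Ω] [IsProbabilityMeasure (ℙ : Measure Ω)]
    (β : ℝ → ℝ) (hβm : Measurable β) (hβ0 : ∀ s, 0 ≤ s → 0 ≤ β s)
    (hβloc : ∀ a : ℝ, IntervalIntegrable β volume 0 a)
    (B : ℝ → ℝ) (hB : ∀ a, B a = ∫ s in (0 : ℝ)..a, β s)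
    (hBtop : Filter.Tendsto B Filter.atTop Filter.atTop)
    (X σ : Ω → ℝ) (hXm : Measurable X) (hσm : Measurable σ)
    (hindep : IndepFun X σ) (hσ0 : ∀ ω, 0 ≤ σ ω)
    (hdens : Measure.map X ℙ = volume.withDensity fun r =>
      ENNReal.ofReal (if 0 ≤ r then β r * Real.exp (-B r) else 0))
    (F : ℝ → ℝ) (hF : ∀ a, F a = (ℙ {ω | σ ω ≤ a}).toReal) (hFc : Continuous F)
    (T : ℝ) (hT : 0 < T) :
    (ℙ[|{ω | T ≤ X ω + σ ω}]) {ω | T ≤ X ω} =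
      ENNReal.ofReal
        (Real.exp (-B T) /
          ((∫ r in (0 : ℝ)..T, β r * Real.exp (-B r) * (1 - F (T - r)))
            + Real.exp (-B T))) := by
  have hBf : B = fun a => ∫ s in (0 : ℝ)..a, β s := funext hB
  have hBc : Continuous B := by
    rw [hBf]
    exact intervalIntegral.continuous_primitive (fun a b => (hβloc a).symm.trans (hβloc b)) 0
  have hdm : Measurable fun r => ENNReal.ofReal (if 0 ≤ r then β r * Real.exp (-B r) else 0) := by
    have hBm := hBc.measurable
    exact (Measurable.ite measurableSet_Ici (by fun_prop) measurable_const).ennreal_ofReal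
  have hF1 : ∀ a, F a ≤ 1 := fun a => by rw [hF]; exact measureReal_le_one
  haveI : IsProbabilityMeasure (Measure.map X ℙ) := Measure.isProbabilityMeasure_map hXm.aemeasurable
  haveI : IsProbabilityMeasure (Measure.map σ ℙ) := Measure.isProbabilityMeasure_map hσm.aemeasurable
  have hlt : Measure.map X ℙ (Set.Iio T) = ENNReal.ofReal (1 - Real.exp (-B T)) := by
    rw [hdens, withDensity_apply _ measurableSet_Iio, ← aux_int β hβ0 hβloc B hB T hT]
    simpa using aux_dens β hβm hβ0 hβloc B hBc (fun _ => 1) continuous_const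
      (fun _ => zero_le_one) T hT
  have hBT : 0 ≤ B T := by
    rw [hB]
    exact intervalIntegral.integral_nonneg hT.le (fun u hu => hβ0 u hu.1)
  have hge : Measure.map X ℙ (Set.Ici T) = ENNReal.ofReal (Real.exp (-B T)) := by
    rw [← Set.compl_Iio, prob_compl_eq_one_sub measurableSet_Iio, hlt, ← ENNReal.ofReal_one,
      ← ENNReal.ofReal_sub _ (by
        have : Real.exp (-B T) ≤ 1 := Real.exp_le_one_iff.2 (by linarith)
        linarith)]
    ring_nf
  have hPX : ℙ {ω | T ≤ X ω} = ENNReal.ofReal (Real.exp (-B T)) := by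
    rw [← hge, Measure.map_apply hXm measurableSet_Ici]; rfl
  have hSm : MeasurableSet {p : ℝ × ℝ | T ≤ p.1 + p.2} :=
    measurableSet_le measurable_const (by fun_prop)
  have hDm : MeasurableSet {ω | T ≤ X ω + σ ω} :=
    measurableSet_le measurable_const (by fun_prop)
  have hsec : ∀ x, Measure.map σ ℙ (Prod.mk x ⁻¹' {p : ℝ × ℝ | T ≤ p.1 + p.2})
      = ENNReal.ofReal (1 - F (T - x)) := by
    intro x
    rw [← aux_tail σ hσm F hF hFc, Measure.map_apply hσm (measurable_prodMk_left hSm)]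
    congr 1
    ext ω
    simp only [Set.mem_preimage, Set.mem_setOf_eq]
    constructor <;> intro h <;> linarith
  have hInn : 0 ≤ ∫ r in (0 : ℝ)..T, β r * Real.exp (-B r) * (1 - F (T - r)) :=
    intervalIntegral.integral_nonneg hT.le (fun u hu =>
      mul_nonneg (mul_nonneg (hβ0 u hu.1) (Real.exp_pos _).le) (by linarith [hF1 (T - u)]))
  have hPD : ℙ {ω | T ≤ X ω + σ ω} = ENNReal.ofReal
      ((∫ r in (0 : ℝ)..T, β r * Real.exp (-B r) * (1 - F (T - r))) + Real.exp (-B T)) := by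
    have hmap := (indepFun_iff_map_prod_eq_prod_map_map hXm.aemeasurable hσm.aemeasurable).1 hindep
    have h1 : ℙ {ω | T ≤ X ω + σ ω}
        = Measure.map (fun ω => (X ω, σ ω)) ℙ {p : ℝ × ℝ | T ≤ p.1 + p.2} := by
      rw [Measure.map_apply (by fun_prop) hSm]; rfl
    have hφm : Measurable fun x => ENNReal.ofReal (1 - F (T - x)) := by
      have := hFc.measurable
      fun_prop
    rw [h1, hmap, Measure.prod_apply hSm]
    simp_rw [hsec]
    rw [← lintegral_add_compl _ (measurableSet_Iio (a := T)), ENNReal.ofReal_add hInn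
      (Real.exp_pos _).le]
    congr 1
    · rw [hdens, restrict_withDensity measurableSet_Iio,
        lintegral_withDensity_eq_lintegral_mul _ hdm hφm]
      exact aux_dens β hβm hβ0 hβloc B hBc (fun x => 1 - F (T - x)) (by fun_prop)
        (fun x => by linarith [hF1 (T - x)]) T hT
    · rw [Set.compl_Iio, ← hge, ← setLIntegral_one]
      apply setLIntegral_congr_fun measurableSet_Ici
      intro x hx
      have hx : T ≤ x := hx
      change ENNReal.ofReal (1 - F (T - x)) = 1
      rw [← aux_tail σ hσm F hF hFc]
      have : {ω | T - x ≤ σ ω} = Set.univ := by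
        ext ω; simp; linarith [hσ0 ω]
      rw [this, measure_univ]
  have hsub : {ω | T ≤ X ω} ⊆ {ω | T ≤ X ω + σ ω} :=
    fun ω (h : T ≤ X ω) => show T ≤ X ω + σ ω by linarith [hσ0 ω]
  rw [cond_apply hDm, Set.inter_eq_right.2 hsub, hPD, hPX,
    ENNReal.ofReal_div_of_pos (add_pos_of_nonneg_of_pos hInn (Real.exp_pos _)),
    ENNReal.div_eq_inv_mul]
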